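/- arXiv:2205.07363 — 2 statements merged into one kernel-verified Lean document; each statement's English description precedes it below -/
import Mathlib

section
/- Let X_1, X_2, X_3 ∈ ℂ and set X_{-n} = conj(X_n) for n = 1,2,3. Define g : ℝ → ℝ by g(β) = (1/2π) ∫_0^{2π} exp( β Σ_{1 ≤ |n| ≤ 3} X_n e^{i n θ} ) dθ. Then the third derivative of g at 0 is g'''(0) = 3!·[ (1/2) Re-sum ] = 3 X_1² X_{-2} + 3 X_{-1}² X_2 + 6 X_1 X_2 X_{-3} + 6 X_{-1} X_{-2} X_3, i.e. g'''(0) = 6 Re(X_1² conj(X_2)) + 12 Re(X_1 X_2 conj(X_3)). -/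
open Complex Real intervalIntegral

open MeasureTheory ProbabilityTheory ComplexConjugate

/-- Differentiating `n` times under the integral sign at `β = 0`. -/
lemma iteratedDeriv_intervalIntegral_exp_mul_zero {f : ℝ → ℝ} (hf : Continuous f) {a b : ℝ}
    (hab : a ≤ b) (n : ℕ) :
    iteratedDeriv n (fun β : ℝ => ∫ θ in a..b, Real.exp (β * f θ)) 0 = ∫ θ in a..b, f θ ^ n := by
  have hmgf : (fun β : ℝ => ∫ θ in a..b, Real.exp (β * f θ)) =
      mgf f (volume.restrict (Set.Ioc a b)) := by
    ext β
    rw [integral_of_le hab, mgf]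
  have hset : integrableExpSet f (volume.restrict (Set.Ioc a b)) = Set.univ := by
    refine Set.eq_univ_of_forall fun t => ?_
    have hcont : Continuous fun θ => Real.exp (t * f θ) := by fun_prop
    exact (hcont.intervalIntegrable a b).1
  rw [hmgf, iteratedDeriv_mgf_zero (by simp [hset]), integral_of_le hab]
  simp only [Pi.pow_apply]

/-- The mean value property for the real part of an entire function on the unit circle. -/
lemma integral_re_exp_mul_I {H : ℂ → ℂ} (hH : Differentiable ℂ H) :
    1 / (2 * π) * ∫ θ in (0 : ℝ)..(2 * π), (H (Complex.exp (θ * I))).re = (H 0).re := by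
  have hmean : circleAverage H 0 1 = H 0 := hH.diffContOnCl.circleAverage
  have hcont : Continuous fun θ : ℝ => H (Complex.exp (θ * I)) :=
    hH.continuous.comp (by fun_prop)
  have hre : ∫ θ in (0 : ℝ)..(2 * π), (H (Complex.exp (θ * I))).re =
      (∫ θ in (0 : ℝ)..(2 * π), H (Complex.exp (θ * I))).re :=
    Complex.reCLM.intervalIntegral_comp_comm (hcont.intervalIntegrable _ _)
  rw [hre, ← hmean, circleAverage_def]
  simp [circleMap]

/-- An entire function whose real part on the unit circle is `(2 Re (a z + b z² + c z³))³`. -/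
def cubicModes (a b c z : ℂ) : ℂ :=
  2 * (a * z + b * z ^ 2 + c * z ^ 3) ^ 3 +
    6 * ((a ^ 2 * conj b + 2 * a * b * conj c) +
      (conj (a ^ 2 * conj c) + (b ^ 2 + 2 * a * c) * conj c + 2 * a * b * conj b
        + a ^ 2 * conj a) * z +
      (2 * b * c * conj c + (b ^ 2 + 2 * a * c) * conj b + 2 * a * b * conj a) * z ^ 2 +
      (c ^ 2 * conj c + 2 * b * c * conj b + (b ^ 2 + 2 * a * c) * conj a) * z ^ 3 +
      (c ^ 2 * conj b + 2 * b * c * conj a) * z ^ 4 + c ^ 2 * conj a * z ^ 5)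

lemma two_mul_re_pow_three (p : ℂ) : (2 * p.re) ^ 3 = (2 * p ^ 3 + 6 * (p ^ 2 * conj p)).re := by
  simp [pow_succ]
  ring

lemma two_mul_re_pow_three_eq_re_cubicModes (a b c : ℂ) {z : ℂ} (hz : z * conj z = 1) :
    (2 * (a * z + b * z ^ 2 + c * z ^ 3).re) ^ 3 = (cubicModes a b c z).re := by
  have hflip : (conj (a ^ 2 * conj c) * z).re = (a ^ 2 * conj c * conj z).re := by
    rw [← Complex.conj_re, map_mul, Complex.conj_conj]
  have hexpand : 2 * (a * z + b * z ^ 2 + c * z ^ 3) ^ 3 +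
      6 * ((a * z + b * z ^ 2 + c * z ^ 3) ^ 2 * conj (a * z + b * z ^ 2 + c * z ^ 3)) =
      cubicModes a b c z +
        (6 : ℝ) * (a ^ 2 * conj c * conj z - conj (a ^ 2 * conj c) * z) := by
    have hinv : conj z = z⁻¹ := eq_inv_of_mul_eq_one_right hz
    have hz0 : z ≠ 0 := left_ne_zero_of_mul_eq_one hz
    simp only [cubicModes, map_add, map_mul, map_pow, hinv, Complex.conj_conj]
    push_cast
    field_simp
    ring
  rw [two_mul_re_pow_three, hexpand, Complex.add_re, Complex.re_ofReal_mul, Complex.sub_re, hflip]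
  ring

lemma differentiable_cubicModes (a b c : ℂ) : Differentiable ℂ (cubicModes a b c) := by
  unfold cubicModes
  fun_prop

/-- The cubic term in the zero-mode Fourier coefficient of `exp(βX)` for
`X(θ) = Σ_{1 ≤ |n| ≤ 3} X_n e^{inθ}` with `X_{−n} = conj(X_n)`: writing
`g(β) = (1/2π) ∫_0^{2π} e^{βX(θ)} dθ`, one has
`g'''(0) = 6 Re(X₁² conj(X₂)) + 12 Re(X₁X₂ conj(X₃))`. -/
theorem zero_mode_cubic_coefficient
    (X₁ X₂ X₃ : ℂ)
    (g : ℝ → ℝ)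
    (hg : ∀ β : ℝ, g β = (1 / (2 * π)) * ∫ θ in (0:ℝ)..(2 * π),
      Real.exp (β *
        (X₁ * Complex.exp (Complex.I * θ) + X₂ * Complex.exp (Complex.I * 2 * θ) +
          X₃ * Complex.exp (Complex.I * 3 * θ) +
          starRingEnd ℂ X₁ * Complex.exp (-(Complex.I * θ)) +
          starRingEnd ℂ X₂ * Complex.exp (-(Complex.I * 2 * θ)) +
          starRingEnd ℂ X₃ * Complex.exp (-(Complex.I * 3 * θ))).re)) :
    iteratedDeriv 3 g 0 =
      6 * (X₁ ^ 2 * starRingEnd ℂ X₂).re + 12 * (X₁ * X₂ * starRingEnd ℂ X₃).re := by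
  set f : ℝ → ℝ := fun θ => (X₁ * Complex.exp (I * θ) + X₂ * Complex.exp (I * 2 * θ) +
    X₃ * Complex.exp (I * 3 * θ) + conj X₁ * Complex.exp (-(I * θ)) +
    conj X₂ * Complex.exp (-(I * 2 * θ)) + conj X₃ * Complex.exp (-(I * 3 * θ))).re with hf
  have hcont : Continuous f := by fun_prop
  have hcube (θ : ℝ) : f θ ^ 3 = (cubicModes X₁ X₂ X₃ (Complex.exp (θ * I))).re := by
    have hconj : conj (Complex.exp (θ * I)) = Complex.exp (-(θ * I)) := by
      rw [← Complex.exp_conj]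
      simp
    rw [← two_mul_re_pow_three_eq_re_cubicModes _ _ _
      (by rw [hconj, ← Complex.exp_add, add_neg_cancel, Complex.exp_zero])]
    congr 1
    set p := X₁ * Complex.exp (θ * I) + X₂ * Complex.exp (θ * I) ^ 2 +
      X₃ * Complex.exp (θ * I) ^ 3 with hp
    have hsum : f θ = (p + conj p).re := by
      simp only [hf, hp, map_add, map_mul, map_pow, hconj]
      simp only [← Complex.exp_nat_mul]
      push_cast
      ring_nf
    rw [hsum, Complex.add_re, Complex.conj_re, two_mul]
  have hgf : g = fun β => 1 / (2 * π) * ∫ θ in (0 : ℝ)..(2 * π), Real.exp (β * f θ) := funext hg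
  rw [hgf, iteratedDeriv_const_mul_field,
    iteratedDeriv_intervalIntegral_exp_mul_zero hcont Real.two_pi_pos.le]
  simp only [hcube]
  rw [integral_re_exp_mul_I (differentiable_cubicModes X₁ X₂ X₃)]
  simp [cubicModes]
  ring
end

section
/- Let μ > 0 and β > 0. Then the integral ∫_0^∞ e^{−μ e^{βx}} dx converges, the integral ∫_{−∞}^0 ( 1 − e^{−μ e^{βx}} ) dx converges, and ∫_0^∞ e^{−μ e^{βx}} dx − ∫_{−∞}^0 ( 1 − e^{−μ e^{βx}} ) dx = −(1/β)( γ + log μ ), where γ is the Euler–Mascheroni constant. -/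
open MeasureTheory Real

open Set Filter Topology

theorem integral_log_mul_exp_neg :
    ∫ t in Ioi (0 : ℝ), Real.log t * Real.exp (-t) = -Real.eulerMascheroniConstant := by
  have hre : ∀ᶠ s : ℂ in 𝓝 1, 0 < s.re :=
    Complex.continuous_re.continuousAt.eventually_const_lt (by simp)
  have hGamma := Complex.hasDerivAt_Gamma_one.congr_of_eventuallyEq
    (f₁ := Complex.GammaIntegral) (by
      filter_upwards [hre] with s hs using (Complex.Gamma_eq_integral hs).symm)
  have h := (Complex.hasDerivAt_GammaIntegral (s := 1) (by simp)).unique hGamma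
  simp only [sub_self, Complex.cpow_zero, one_mul] at h
  have hcast : ((∫ t in Ioi (0 : ℝ), Real.log t * Real.exp (-t) : ℝ) : ℂ)
      = ((-Real.eulerMascheroniConstant : ℝ) : ℂ) := by
    rw [← integral_complex_ofReal]
    push_cast at h ⊢
    exact h
  exact_mod_cast hcast

theorem integrableOn_log_mul_exp_neg :
    IntegrableOn (fun t : ℝ => Real.log t * Real.exp (-t)) (Ioi 0) := by
  by_contra h
  have h0 := integral_log_mul_exp_neg
  rw [integral_undef h] at h0
  linarith [Real.one_half_lt_eulerMascheroniConstant]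

theorem image_const_mul_exp_univ {μ β : ℝ} (hμ : 0 < μ) (hβ : 0 < β) :
    (fun x : ℝ => μ * Real.exp (β * x)) '' univ = Ioi 0 := by
  ext t
  simp only [image_univ, mem_range, mem_Ioi]
  constructor
  · rintro ⟨x, rfl⟩
    positivity
  · intro ht
    refine ⟨Real.log (t / μ) / β, ?_⟩
    rw [mul_div_cancel₀ _ hβ.ne', Real.exp_log (by positivity), mul_div_cancel₀ _ hμ.ne']

theorem hasDerivAt_const_mul_exp (μ β x : ℝ) :
    HasDerivAt (fun x : ℝ => μ * Real.exp (β * x)) (μ * (Real.exp (β * x) * β)) x := by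
  simpa using (((hasDerivAt_id x).const_mul β).exp.const_mul μ)

theorem hasDerivAt_exp_neg_mul_exp (μ β x : ℝ) :
    HasDerivAt (fun x : ℝ => Real.exp (-μ * Real.exp (β * x)))
      (Real.exp (-μ * Real.exp (β * x)) * (-μ * (Real.exp (β * x) * β))) x :=
  (hasDerivAt_const_mul_exp (-μ) β x).exp

/-- The substitution `t = μ e^{βx}` turns the first moment of the derivative of
`e^{-μ e^{βx}}` into an integral of `log t * e^{-t}`. -/
theorem integrable_and_integral_id_mul_deriv_exp_neg_mul_exp {μ β : ℝ}
    (hμ : 0 < μ) (hβ : 0 < β) :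
    Integrable (fun x : ℝ =>
        x * (Real.exp (-μ * Real.exp (β * x)) * (-μ * (Real.exp (β * x) * β)))) ∧
      ∫ x : ℝ, x * (Real.exp (-μ * Real.exp (β * x)) * (-μ * (Real.exp (β * x) * β))) =
        (1 / β) * (Real.eulerMascheroniConstant + Real.log μ) := by
  set g : ℝ → ℝ := fun t => -(1 / β) * (Real.log t * Real.exp (-t)
    - Real.log μ * Real.exp (-t)) with hg
  have hexp : IntegrableOn (fun t : ℝ => Real.exp (-t)) (Ioi 0) := integrableOn_exp_neg_Ioi 0
  have hgi : IntegrableOn g (Ioi 0) :=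
    (integrableOn_log_mul_exp_neg.sub (hexp.const_mul _)).const_mul _
  have hgint : ∫ t in Ioi (0 : ℝ), g t =
      (1 / β) * (Real.eulerMascheroniConstant + Real.log μ) := by
    rw [hg, integral_const_mul, integral_sub integrableOn_log_mul_exp_neg (hexp.const_mul _),
      integral_const_mul, integral_log_mul_exp_neg, integral_exp_neg_Ioi_zero]
    ring
  have hderiv : ∀ x ∈ (univ : Set ℝ), HasDerivWithinAt (fun x : ℝ => μ * Real.exp (β * x))
      (μ * (Real.exp (β * x) * β)) univ x :=
    fun x _ => (hasDerivAt_const_mul_exp μ β x).hasDerivWithinAt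
  have hinj : InjOn (fun x : ℝ => μ * Real.exp (β * x)) univ := by
    intro x _ y _ h
    simpa [hμ.ne', hβ.ne'] using h
  have hcongr : (fun x : ℝ => |μ * (Real.exp (β * x) * β)| • g (μ * Real.exp (β * x))) =
      fun x => x * (Real.exp (-μ * Real.exp (β * x)) * (-μ * (Real.exp (β * x) * β))) := by
    funext x
    rw [abs_of_pos (by positivity), hg]
    simp only [smul_eq_mul]
    rw [Real.log_mul hμ.ne' (Real.exp_pos _).ne', Real.log_exp, neg_mul μ]
    field_simp
    ring
  rw [← image_const_mul_exp_univ hμ hβ] at hgi hgint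
  rw [integrableOn_image_iff_integrableOn_abs_deriv_smul .univ hderiv hinj, hcongr,
    integrableOn_univ] at hgi
  rw [integral_image_eq_integral_abs_deriv_smul .univ hderiv hinj, hcongr,
    setIntegral_univ] at hgint
  exact ⟨hgi, hgint⟩

theorem exp_neg_mul_exp_le {μ : ℝ} (hμ : 0 < μ) (β x : ℝ) :
    Real.exp (-μ * Real.exp (β * x)) ≤ Real.exp (-(μ * β) * x) := by
  rw [Real.exp_le_exp]
  nlinarith [Real.add_one_le_exp (β * x)]

theorem one_sub_exp_neg_mul_exp_nonneg {μ : ℝ} (hμ : 0 < μ) (β x : ℝ) :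
    0 ≤ 1 - Real.exp (-μ * Real.exp (β * x)) := by
  rw [sub_nonneg, Real.exp_le_one_iff]
  nlinarith [Real.exp_pos (β * x)]

theorem one_sub_exp_neg_mul_exp_le (μ β x : ℝ) :
    1 - Real.exp (-μ * Real.exp (β * x)) ≤ μ * Real.exp (β * x) := by
  linarith [Real.add_one_le_exp (-μ * Real.exp (β * x))]

theorem integrableOn_exp_neg_mul_exp {μ β : ℝ} (hμ : 0 < μ) (hβ : 0 < β) :
    IntegrableOn (fun x : ℝ => Real.exp (-μ * Real.exp (β * x))) (Ioi 0) := by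
  refine (integrableOn_exp_mul_Ioi (a := -(μ * β)) (by nlinarith [mul_pos hμ hβ]) 0).mono'
    (by fun_prop) (ae_of_all _ fun x => ?_)
  rw [Real.norm_of_nonneg (Real.exp_pos _).le]
  exact exp_neg_mul_exp_le hμ β x

theorem integrableOn_one_sub_exp_neg_mul_exp {μ β : ℝ} (hμ : 0 < μ) (hβ : 0 < β) :
    IntegrableOn (fun x : ℝ => 1 - Real.exp (-μ * Real.exp (β * x))) (Iic 0) := by
  refine ((integrableOn_exp_mul_Iic hβ 0).const_mul μ).mono'
    (by fun_prop) (ae_of_all _ fun x => ?_)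
  rw [Real.norm_of_nonneg (one_sub_exp_neg_mul_exp_nonneg hμ β x)]
  exact one_sub_exp_neg_mul_exp_le μ β x

theorem tendsto_id_mul_exp_neg_mul_atTop {b : ℝ} (hb : 0 < b) :
    Tendsto (fun x : ℝ => x * Real.exp (-b * x)) atTop (𝓝 0) := by
  simpa using tendsto_rpow_mul_exp_neg_mul_atTop_nhds_zero 1 b hb

theorem tendsto_id_mul_exp_neg_mul_exp_atTop {μ β : ℝ} (hμ : 0 < μ) (hβ : 0 < β) :
    Tendsto (fun x : ℝ => x * Real.exp (-μ * Real.exp (β * x))) atTop (𝓝 0) := by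
  refine squeeze_zero' ?_ ?_ (tendsto_id_mul_exp_neg_mul_atTop (mul_pos hμ hβ))
  · filter_upwards [eventually_ge_atTop 0] with x hx
    positivity
  · filter_upwards [eventually_ge_atTop 0] with x hx
    exact mul_le_mul_of_nonneg_left (exp_neg_mul_exp_le hμ β x) hx

theorem tendsto_id_mul_one_sub_exp_neg_mul_exp_atBot {μ β : ℝ} (hμ : 0 < μ) (hβ : 0 < β) :
    Tendsto (fun x : ℝ => x * (1 - Real.exp (-μ * Real.exp (β * x)))) atBot (𝓝 0) := by
  have h : Tendsto (fun x : ℝ => μ * (-x * Real.exp (-β * -x))) atBot (𝓝 0) := by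
    simpa using ((tendsto_id_mul_exp_neg_mul_atTop hβ).comp tendsto_neg_atBot_atTop).const_mul μ
  refine squeeze_zero_norm' ?_ h
  filter_upwards [eventually_le_atBot 0] with x hx
  rw [norm_mul, Real.norm_of_nonpos hx,
    Real.norm_of_nonneg (one_sub_exp_neg_mul_exp_nonneg hμ β x), neg_mul_neg, mul_left_comm]
  exact mul_le_mul_of_nonneg_left (one_sub_exp_neg_mul_exp_le μ β x) (by linarith)

/-- The regularized Liouville zero-mode integral: the divergent integral
`∫_{-∞}^{∞} e^{−μe^{βx}} dx` is regularized by subtracting the constant contribution at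
`x → −∞`, giving `−(1/β)(γ + log μ)`. -/
theorem liouville_zero_mode_regularized_integral (μ β : ℝ) (hμ : 0 < μ) (hβ : 0 < β) :
    IntegrableOn (fun x : ℝ => Real.exp (-μ * Real.exp (β * x))) (Set.Ioi 0) ∧
    IntegrableOn (fun x : ℝ => 1 - Real.exp (-μ * Real.exp (β * x))) (Set.Iio 0) ∧
    (∫ x in Set.Ioi (0:ℝ), Real.exp (-μ * Real.exp (β * x))) -
        (∫ x in Set.Iio (0:ℝ), (1 - Real.exp (-μ * Real.exp (β * x)))) =
      -(1 / β) * (Real.eulerMascheroniConstant + Real.log μ) := by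
  have hpos := integrableOn_exp_neg_mul_exp hμ hβ
  have hneg := integrableOn_one_sub_exp_neg_mul_exp hμ hβ
  refine ⟨hpos, hneg.mono_set Iio_subset_Iic_self, ?_⟩
  obtain ⟨hmom, hval⟩ := integrable_and_integral_id_mul_deriv_exp_neg_mul_exp hμ hβ
  have hright := integral_Ioi_of_hasDerivAt_of_tendsto' (a := 0)
    (fun x _ => (hasDerivAt_id' x).mul (hasDerivAt_exp_neg_mul_exp μ β x))
    (by simpa only [one_mul] using! hpos.add hmom.integrableOn)
    (tendsto_id_mul_exp_neg_mul_exp_atTop hμ hβ)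
  have hleft := integral_Iic_of_hasDerivAt_of_tendsto' (a := 0)
    (fun x _ => (hasDerivAt_id' x).mul ((hasDerivAt_exp_neg_mul_exp μ β x).const_sub 1))
    (by simpa only [one_mul, mul_neg, ← sub_eq_add_neg] using! hneg.sub hmom.integrableOn)
    (tendsto_id_mul_one_sub_exp_neg_mul_exp_atBot hμ hβ)
  simp only [one_mul, Pi.mul_apply, zero_mul, sub_zero] at hright
  rw [integral_add hpos hmom.integrableOn] at hright
  simp only [one_mul, Pi.mul_apply, zero_mul, sub_zero, mul_neg _ (_ * (_ : ℝ)),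
    ← sub_eq_add_neg] at hleft
  rw [integral_sub hneg hmom.integrableOn] at hleft
  rw [← intervalIntegral.integral_Iic_add_Ioi hmom.integrableOn hmom.integrableOn (b := 0)] at hval
  rw [← integral_Iic_eq_integral_Iio]
  linarith
end
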